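/- Let n ≥ 3 and let λ = (λ_1,…,λ_k) be a composition of n−1 with λ_1 ≥ 2 and λ_k ≥ 2. Define integers f_{−1} = 0, f_0 = 1, and f_j = λ_j·f_{j−1} + f_{j−2} for 1 ≤ j ≤ k. Then |det(H_λ)| = f_k; that is, the absolute determinant of H_λ equals the numerator of the continued fraction [λ_1; λ_2, …, λ_k] = λ_1 + 1/(λ_2 + 1/(⋯ + 1/λ_k)). -/

import Mathlib

open Matrix BigOperators

/-- The unreduced upper Hessenberg 0/1-matrix `H_λ` associated with a composition
`λ = (λ_1, …, λ_K)` (given as `lam : Fin K → ℕ`, 0-indexed) of `n - 1`.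
With 1-based indices: `σ_j = λ_1 + … + λ_j`, `β c` is the unique `j` with
`σ_{j-1} < c ≤ σ_j`, the row-block `ρ r` is `0` for `r = 1` and `β (r-1)` otherwise,
and the column-block `γ c` is `β c` for `c ≤ n-1` and `K + 1` for `c = n`.
Then `H_λ(r,c) = 1` iff `r = c + 1`, or `ρ r < γ c` and `γ c - ρ r` is odd. -/
def Hmat (n K : ℕ) (lam : Fin K → ℕ) : Matrix (Fin n) (Fin n) ℝ :=
  Matrix.of fun i j =>
    let β : ℕ → ℕ := fun c =>
      ((Finset.range K).filter fun t => (∑ s : Fin K, if (s : ℕ) < t then lam s else 0) < c).card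
    let ρ : ℕ → ℕ := fun r => if r = 1 then 0 else β (r - 1)
    let γ : ℕ → ℕ := fun c => if c ≤ n - 1 then β c else K + 1
    if ((i : ℕ) = (j : ℕ) + 1) ∨
        (ρ ((i : ℕ) + 1) < γ ((j : ℕ) + 1) ∧ (γ ((j : ℕ) + 1) - ρ ((i : ℕ) + 1)) % 2 = 1)
    then 1 else 0

/-- The continued fraction numerator recursion: `contFracNum lam (j+1)` is `f_j`
where `f_{-1} = 0`, `f_0 = 1` and `f_j = λ_j f_{j-1} + f_{j-2}` (with `λ_j = lam (j-1)`,
i.e. `lam` lists the partial quotients 0-indexed). -/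
def contFracNum (lam : ℕ → ℕ) : ℕ → ℕ
  | 0 => 0
  | 1 => 1
  | j + 2 => lam j * contFracNum lam (j + 1) + contFracNum lam j

/-- If a vector `x` with `x 0 = 1` is sent by an unreduced upper Hessenberg matrix with unit
subdiagonal to a multiple of the last coordinate functional, that multiple is the determinant
up to sign. -/
theorem abs_det_of_hessenberg {m : ℕ} (M : Matrix (Fin (m + 1)) (Fin (m + 1)) ℝ)
    (hone : ∀ i : Fin m, M i.succ i.castSucc = 1)
    (hzero : ∀ i j : Fin m, j < i → M i.succ j.castSucc = 0)
    (x : Fin (m + 1) → ℝ) (d : ℝ) (hx : x 0 = 1) (hM : x ᵥ* M = Pi.single (Fin.last m) d) :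
    |M.det| = |d| := by
  have hrow : (M.updateRow 0 (x ᵥ* M)).det = M.det := by
    have := Matrix.det_updateRow_sum M 0 x
    rw [hx, one_smul] at this
    rw [← this]
    congr 2
    ext j
    simp [Matrix.vecMul, dotProduct]
  have htri : (M.submatrix Fin.succ (Fin.castSucc : Fin m → Fin (m + 1))).det = 1 := by
    rw [Matrix.det_of_isUpperTriangular]
    · exact Finset.prod_eq_one fun i _ => hone i
    · intro i j hij
      exact hzero i j hij
  rw [← hrow, hM, Matrix.det_succ_row_zero, Finset.sum_eq_single (Fin.last m)]
  · have hsub : (M.updateRow 0 (Pi.single (Fin.last m) d)).submatrix Fin.succ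
        (Fin.last m).succAbove = M.submatrix Fin.succ (Fin.castSucc : Fin m → Fin (m + 1)) := by
      ext i j
      simp [Fin.succ_ne_zero]
    rw [hsub, htri]
    simp [abs_mul]
  · intro j _ hj
    simp [hj]
  · simp

/-- The sum of the parts of `lam` with index less than `t`. -/
def partialSum {K : ℕ} (lam : Fin K → ℕ) (t : ℕ) : ℕ :=
  ∑ s : Fin K, if (s : ℕ) < t then lam s else 0

/-- The number of partial sums of `lam` (the full sum excluded) which are less than `c`. -/
def blockIndex {K : ℕ} (lam : Fin K → ℕ) (c : ℕ) : ℕ :=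
  ((Finset.range K).filter fun t => partialSum lam t < c).card

section Composition

variable {K : ℕ} (lam : Fin K → ℕ)

theorem partialSum_zero : partialSum lam 0 = 0 := by simp [partialSum]

theorem partialSum_self : partialSum lam K = ∑ i, lam i := by simp [partialSum]

theorem partialSum_succ (t : Fin K) :
    partialSum lam (t + 1) = partialSum lam t + lam t := by
  have h : lam t = ∑ s : Fin K, if s = t then lam s else 0 := by simp
  rw [h, partialSum, partialSum, ← Finset.sum_add_distrib]
  refine Finset.sum_congr rfl fun s _ => ?_
  rcases lt_trichotomy s t with hs | rfl | hs
  · have : (s : ℕ) < t := hs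
    simp [hs.ne, this, this.trans (Nat.lt_succ_self _)]
  · simp
  · have : (t : ℕ) < s := hs
    simp [hs.ne', this.not_gt, show ¬ (s : ℕ) < t + 1 by omega]

theorem partialSum_mono : Monotone (partialSum lam) := by
  intro a b hab
  refine Finset.sum_le_sum fun s _ => ?_
  split_ifs <;> omega

theorem blockIndex_mono : Monotone (blockIndex lam) := by
  intro a b hab
  refine Finset.card_le_card fun t => ?_
  simp only [Finset.mem_filter]
  exact fun h => ⟨h.1, h.2.trans_le hab⟩

theorem blockIndex_zero : blockIndex lam 0 = 0 := by simp [blockIndex]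

theorem blockIndex_le (c : ℕ) : blockIndex lam c ≤ K := by
  simpa [blockIndex] using
    Finset.card_filter_le (Finset.range K) fun t => partialSum lam t < c

theorem blockIndex_pos (hK : 0 < K) {c : ℕ} (hc : 0 < c) : 0 < blockIndex lam c :=
  Finset.card_pos.2 ⟨0, by simp [hK, partialSum_zero, hc]⟩

theorem blockIndex_le_iff {t c : ℕ} (ht : t ≤ K) (hc : c ≤ ∑ i, lam i) :
    blockIndex lam c ≤ t ↔ c ≤ partialSum lam t := by
  constructor
  · intro h
    by_contra! hlt
    have htK : t < K := by
      refine lt_of_le_of_ne ht ?_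
      rintro rfl
      rw [partialSum_self] at hlt
      omega
    have hsub : Finset.range (t + 1) ⊆
        (Finset.range K).filter fun s => partialSum lam s < c := by
      intro s hs
      rw [Finset.mem_range] at hs
      rw [Finset.mem_filter, Finset.mem_range]
      exact ⟨by omega, (partialSum_mono lam (by omega)).trans_lt hlt⟩
    have hcard := Finset.card_le_card hsub
    rw [Finset.card_range] at hcard
    exact absurd h (not_le.2 hcard)
  · intro h
    have hsub : ((Finset.range K).filter fun s => partialSum lam s < c) ⊆ Finset.range t := by
      intro s hs
      rw [Finset.mem_filter] at hs
      rw [Finset.mem_range]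
      by_contra! hts
      exact absurd (partialSum_mono lam hts) (not_le.2 (hs.2.trans_le h))
    simpa [blockIndex] using Finset.card_le_card hsub

theorem card_blockIndex_eq_zero :
    ((Finset.range (∑ i, lam i + 1)).filter fun c => blockIndex lam c = 0).card = 1 := by
  rw [Finset.card_eq_one]
  refine ⟨0, ?_⟩
  ext c
  simp only [Finset.mem_filter, Finset.mem_range, Finset.mem_singleton]
  constructor
  · rintro ⟨hc, h⟩
    have := (blockIndex_le_iff lam (Nat.zero_le K) (Nat.lt_succ_iff.1 hc)).1 h.le
    rwa [partialSum_zero, Nat.le_zero] at this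
  · rintro rfl
    exact ⟨Nat.succ_pos _, blockIndex_zero lam⟩

theorem card_blockIndex_eq_succ (t : Fin K) :
    ((Finset.range (∑ i, lam i + 1)).filter fun c => blockIndex lam c = t + 1).card = lam t := by
  have hfil : ((Finset.range (∑ i, lam i + 1)).filter fun c => blockIndex lam c = t + 1) =
      Finset.Ioc (partialSum lam t) (partialSum lam (t + 1)) := by
    ext c
    have hle : partialSum lam (t + 1) ≤ ∑ i, lam i :=
      partialSum_self lam ▸ partialSum_mono lam t.2
    simp only [Finset.mem_filter, Finset.mem_range, Finset.mem_Ioc]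
    have hiff (hc : c ≤ ∑ i, lam i) :
        blockIndex lam c = t + 1 ↔ partialSum lam t < c ∧ c ≤ partialSum lam (t + 1) := by
      rw [← blockIndex_le_iff lam t.2 hc, ← not_le, ← blockIndex_le_iff lam t.2.le hc]
      omega
    constructor
    · rintro ⟨hc, h⟩
      exact (hiff (Nat.lt_succ_iff.1 hc)).1 h
    · intro h
      exact ⟨by omega, (hiff (h.2.trans hle)).2 h⟩
  rw [hfil, Nat.card_Ioc, partialSum_succ]
  omega

end Composition

/-- The common value, on the rows of block `t`, of the vector reducing `Hmat` to its last
column. -/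
noncomputable def blockWeight (f : ℕ → ℕ) (t : ℕ) : ℝ :=
  if t = 0 then 1 else (-1) ^ t * contFracNum f t

theorem sum_blockWeight {K : ℕ} (lam : Fin K → ℕ) (f : ℕ → ℕ) (hf : ∀ t : Fin K, f t = lam t) :
    ∀ B, 0 < B → B ≤ K + 1 →
      ∑ c ∈ Finset.range (∑ i, lam i + 1),
        (if blockIndex lam c < B ∧ (B - blockIndex lam c) % 2 = 1
          then blockWeight f (blockIndex lam c) else 0) = -blockWeight f B
  | 0, h, _ => absurd h (lt_irrefl 0)
  | 1, _, _ => by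
    have hcongr (c : ℕ) : (if blockIndex lam c < 1 ∧ (1 - blockIndex lam c) % 2 = 1
        then blockWeight f (blockIndex lam c) else 0) =
        if blockIndex lam c = 0 then (1 : ℝ) else 0 := by
      by_cases h : blockIndex lam c = 0 <;> simp [h, blockWeight]
    simp_rw [hcongr]
    rw [Finset.sum_boole, card_blockIndex_eq_zero]
    simp [blockWeight, contFracNum]
  | B + 2, _, hB => by
    have hcongr (c : ℕ) : (if blockIndex lam c < B + 2 ∧ (B + 2 - blockIndex lam c) % 2 = 1
        then blockWeight f (blockIndex lam c) else 0) =
        (if blockIndex lam c < B ∧ (B - blockIndex lam c) % 2 = 1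
          then blockWeight f (blockIndex lam c) else 0) +
        blockWeight f (B + 1) * if blockIndex lam c = B + 1 then (1 : ℝ) else 0 := by
      rcases lt_trichotomy (blockIndex lam c) (B + 1) with h | h | h
      · have hiff : (blockIndex lam c < B + 2 ∧ (B + 2 - blockIndex lam c) % 2 = 1) ↔
            (blockIndex lam c < B ∧ (B - blockIndex lam c) % 2 = 1) := by omega
        simp only [hiff, h.ne, if_false, mul_zero, add_zero]
      · simp [h, show B + 2 - (B + 1) = 1 by omega]
      · simp [show ¬ blockIndex lam c < B + 2 by omega, show ¬ blockIndex lam c < B by omega,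
          h.ne']
    have hcard := card_blockIndex_eq_succ lam ⟨B, by omega⟩
    have hfB : f B = lam ⟨B, by omega⟩ := hf ⟨B, by omega⟩
    simp_rw [hcongr]
    rw [Finset.sum_add_distrib, ← Finset.mul_sum, Finset.sum_boole, hcard, ← hfB]
    rcases Nat.eq_zero_or_pos B with rfl | hpos
    · simp [blockWeight, contFracNum]
    · rw [sum_blockWeight lam f hf B hpos (by omega)]
      simp only [blockWeight, hpos.ne', if_false, contFracNum, Nat.add_eq_zero_iff]
      push_cast
      simp
      ring

/-- The block index of the column `j` of `Hmat`, columns being counted from `0`. -/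
def columnBlock {K : ℕ} (lam : Fin K → ℕ) (n j : ℕ) : ℕ :=
  if j + 1 ≤ n - 1 then blockIndex lam (j + 1) else K + 1

theorem Hmat_apply {n K : ℕ} (lam : Fin K → ℕ) (i j : Fin n) :
    Hmat n K lam i j = if (i : ℕ) = j + 1 ∨ (blockIndex lam i < columnBlock lam n j ∧
      (columnBlock lam n j - blockIndex lam i) % 2 = 1) then 1 else 0 := by
  have hrow : (if (i : ℕ) + 1 = 1 then 0 else blockIndex lam ((i : ℕ) + 1 - 1)) =
      blockIndex lam i := by
    split_ifs with h
    · rw [show (i : ℕ) = 0 by omega, blockIndex_zero]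
    · rfl
  rw [← hrow]
  rfl

theorem lt_of_blockIndex_lt_columnBlock {n K : ℕ} (lam : Fin K → ℕ) (i j : Fin n)
    (h : blockIndex lam i < columnBlock lam n j) : (i : ℕ) < j + 1 := by
  unfold columnBlock at h
  split_ifs at h with hj
  · exact (blockIndex_mono lam).reflect_lt h
  · omega

theorem vecMul_Hmat {n K : ℕ} (lam : Fin K → ℕ) (hK : 0 < K) (hn : n = ∑ i, lam i + 1)
    (f : ℕ → ℕ) (hf : ∀ t : Fin K, f t = lam t) (j : Fin n) :
    ((fun i : Fin n => blockWeight f (blockIndex lam i)) ᵥ* Hmat n K lam) j =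
      if (j : ℕ) + 1 < n then 0 else -blockWeight f (K + 1) := by
  have hsplit (i : Fin n) : blockWeight f (blockIndex lam i) * Hmat n K lam i j =
      (if (i : ℕ) = j + 1 then blockWeight f (blockIndex lam i) else 0) +
      if blockIndex lam i < columnBlock lam n j ∧
        (columnBlock lam n j - blockIndex lam i) % 2 = 1
        then blockWeight f (blockIndex lam i) else 0 := by
    rw [Hmat_apply]
    by_cases hi : (i : ℕ) = j + 1
    · have : ¬ blockIndex lam i < columnBlock lam n j := fun h =>
        (lt_of_blockIndex_lt_columnBlock lam i j h).ne hi
      simp only [hi] at this ⊢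
      simp [this]
    · simp [hi]
  have hpos : 0 < columnBlock lam n j := by
    unfold columnBlock
    split_ifs
    · exact blockIndex_pos lam hK (Nat.succ_pos _)
    · exact Nat.succ_pos _
  have hle : columnBlock lam n j ≤ K + 1 := by
    unfold columnBlock
    split_ifs
    · exact (blockIndex_le lam _).trans (Nat.le_succ K)
    · exact le_rfl
  have hsum := sum_blockWeight lam f hf _ hpos hle
  rw [← hn, Finset.sum_range] at hsum
  rw [Matrix.vecMul, dotProduct, Finset.sum_congr rfl fun i _ => hsplit i,
    Finset.sum_add_distrib, hsum]
  split_ifs with hj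
  · rw [Finset.sum_eq_single ⟨j + 1, hj⟩]
    · simp [columnBlock, show (j : ℕ) + 1 ≤ n - 1 by omega]
    · intro i _ hi
      exact if_neg fun h => hi (Fin.ext h)
    · simp
  · rw [Finset.sum_eq_zero fun i _ => if_neg (by omega)]
    simp [columnBlock, show ¬ (j : ℕ) + 1 ≤ n - 1 by omega]

/-- For `n ≥ 3` and a composition `λ = (λ_1,…,λ_k)` of `n - 1` with first and last part
at least `2`, the absolute determinant of `H_λ` equals the numerator `f_k` of the
continued fraction `[λ_1; λ_2, …, λ_k]`. Here `lam : Fin (k+1) → ℕ` lists the `k+1`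
parts and `f_{k+1} = contFracNum lam' (k+2)`. -/
theorem abs_det_Hmat_eq_contFracNum (n k : ℕ) (hn : 3 ≤ n) (lam : Fin (k + 1) → ℕ)
    (hpos : ∀ i, 0 < lam i) (hsum : ∑ i, lam i = n - 1)
    (hfirst : 2 ≤ lam 0) (hlast : 2 ≤ lam (Fin.last k)) :
    |(Hmat n (k + 1) lam).det| =
      (contFracNum (fun m => if h : m < k + 1 then lam ⟨m, h⟩ else 0) (k + 2) : ℝ) := by
  obtain ⟨m, rfl⟩ : ∃ m, n = m + 1 := ⟨n - 1, by omega⟩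
  rw [abs_det_of_hessenberg (Hmat (m + 1) (k + 1) lam) _ _
    (fun i => blockWeight (fun m => if h : m < k + 1 then lam ⟨m, h⟩ else 0) (blockIndex lam i))
    (-blockWeight (fun m => if h : m < k + 1 then lam ⟨m, h⟩ else 0) (k + 1 + 1))]
  · simp [blockWeight, abs_mul]
  · simp [blockIndex_zero, blockWeight]
  · ext j
    rw [vecMul_Hmat lam (Nat.succ_pos k) (by omega) _ (fun t => by simp only [t.2, dite_true])]
    rcases eq_or_ne j (Fin.last m) with rfl | hj
    · simp
    · have : (j : ℕ) < m := Fin.lt_last_iff_ne_last.2 hj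
      simp [hj, this]
  · intro i
    simp [Hmat_apply]
  · intro i j hji
    rw [Hmat_apply, if_neg]
    have hlt : (j : ℕ) < i := hji
    rintro (h | h)
    · simp at h
      omega
    · have := lt_of_blockIndex_lt_columnBlock lam _ _ h.1
      simp at this
      omega
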